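/- arXiv:2201.09197 — 5 statements merged into one kernel-verified Lean document; each statement's English description precedes it below -/
import Mathlib

section
/- Let X ∈ ℝ^{n1×h} with h = n2·n3 and let 𝒳 ∈ ℝ^{n1×n2×n3} be the tensor obtained by reshaping X, i.e., 𝒳(i,j,k) = X(i, (k−1)n2 + j). Then rank_t(𝒳) ≤ rank(X) ≤ n3 · rank_t(𝒳). -/
/-- The `k`-th Fourier slice of a third order real tensor `A ∈ ℝ^{n1×n2×n3}`:
`Ā^{(k)}_{ij} = Σ_{l=1}^{n3} ω^{(l−1)(k−1)} A_{ijl}` with `ω = exp(−2π i / n3)`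
(0-indexed here, so the exponent is `l·k`). -/
noncomputable def fourierSlice {n1 n2 n3 : ℕ} (A : Fin n1 → Fin n2 → Fin n3 → ℝ)
    (k : Fin n3) : Matrix (Fin n1) (Fin n2) ℂ :=
  Matrix.of fun i j =>
    ∑ l : Fin n3,
      Complex.exp (-(2 * (Real.pi : ℂ) * Complex.I) / (n3 : ℂ)) ^ ((l : ℕ) * (k : ℕ)) *
        (A i j l : ℂ)

/-- The tubal rank of a third order real tensor: `rank_t(A) = max_k rank(Ā^{(k)})`. -/
noncomputable def tubalRank {n1 n2 n3 : ℕ} (A : Fin n1 → Fin n2 → Fin n3 → ℝ) : ℕ :=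
  Finset.univ.sup fun k : Fin n3 => (fourierSlice A k).rank

/-- The column index `j + (k−1)·a` (1-indexed), i.e. `k·a + j` (0-indexed). -/
def colIdx {a b : ℕ} (j : Fin a) (k : Fin b) : Fin (a * b) :=
  ⟨(k : ℕ) * a + (j : ℕ), by
    have hj := j.isLt
    have hk : (k : ℕ) + 1 ≤ b := k.isLt
    have h1 : ((k : ℕ) + 1) * a ≤ b * a := Nat.mul_le_mul_right _ hk
    have h2 : ((k : ℕ) + 1) * a = (k : ℕ) * a + a := Nat.succ_mul _ _
    have h3 : b * a = a * b := Nat.mul_comm _ _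
    omega⟩

/-- Every matrix over a field factors through `r = rank M` dimensions as a left-invertible matrix
times a right-invertible one. -/
theorem Matrix.exists_rank_factorization {K m n : Type*} [Field K] [Fintype m] [Fintype n]
    [DecidableEq m] [DecidableEq n] (M : Matrix m n K) :
    ∃ (A : Matrix m (Fin M.rank) K) (B : Matrix (Fin M.rank) n K)
      (A' : Matrix (Fin M.rank) m K) (B' : Matrix n (Fin M.rank) K),
      M = A * B ∧ A' * A = 1 ∧ B * B' = 1 := by
  let f := Matrix.toLin' M
  have hr : Module.finrank K (LinearMap.range f) = M.rank := rfl
  let e : LinearMap.range f ≃ₗ[K] (Fin M.rank → K) :=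
    (Module.finBasisOfFinrankEq K _ hr).equivFun
  let a : (Fin M.rank → K) →ₗ[K] (m → K) := (LinearMap.range f).subtype ∘ₗ e.symm.toLinearMap
  let b : (n → K) →ₗ[K] (Fin M.rank → K) := e.toLinearMap ∘ₗ f.rangeRestrict
  have hab : a ∘ₗ b = f := by
    ext x
    simp [a, b]
  have ha : LinearMap.ker a = ⊥ :=
    LinearMap.ker_eq_bot.2 ((Submodule.subtype_injective _).comp e.symm.injective)
  have hb : LinearMap.range b = ⊤ :=
    LinearMap.range_eq_top.2 (e.surjective.comp f.surjective_rangeRestrict)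
  obtain ⟨a', ha'⟩ := a.exists_leftInverse_of_injective ha
  obtain ⟨b', hb'⟩ := b.exists_rightInverse_of_surjective hb
  refine ⟨LinearMap.toMatrix' a, LinearMap.toMatrix' b, LinearMap.toMatrix' a',
    LinearMap.toMatrix' b', ?_, ?_, ?_⟩
  · rw [← LinearMap.toMatrix'_comp, hab, LinearMap.toMatrix'_toLin']
  · rw [← LinearMap.toMatrix'_comp, ha', LinearMap.toMatrix'_id]
  · rw [← LinearMap.toMatrix'_comp, hb', LinearMap.toMatrix'_id]

/-- The rank of a matrix is invariant under field extension. -/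
theorem Matrix.rank_map_ringHom {K L m n : Type*} [Field K] [Field L] [Fintype m] [Fintype n]
    (φ : K →+* L) (M : Matrix m n K) : (M.map φ).rank = M.rank := by
  classical
  obtain ⟨A, B, A', B', hM, hA, hB⟩ := M.exists_rank_factorization
  apply le_antisymm
  · calc (M.map φ).rank = (A.map φ * B.map φ).rank := by rw [← Matrix.map_mul, ← hM]
      _ ≤ (A.map φ).rank := Matrix.rank_mul_le_left _ _
      _ ≤ M.rank := by simpa using (A.map φ).rank_le_card_width
  · have h : A' * M * B' = 1 := by
      calc A' * M * B' = (A' * A) * (B * B') := by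
            have hN : ∀ N, N = A * B → A' * N * B' = (A' * A) * (B * B') := by
              rintro _ rfl
              simp only [Matrix.mul_assoc]
            exact hN M hM
        _ = 1 := by rw [hA, hB, Matrix.one_mul]
    calc M.rank = (1 : Matrix (Fin M.rank) (Fin M.rank) L).rank := by simp
      _ = (A'.map φ * M.map φ * B'.map φ).rank := by
          rw [← Matrix.map_mul, ← Matrix.map_mul, h, Matrix.map_one _ φ.map_zero φ.map_one]
      _ ≤ (M.map φ).rank := (Matrix.rank_mul_le_left _ _).trans (Matrix.rank_mul_le_right _ _)

theorem Matrix.rank_sum_le {K ι m n : Type*} [Field K] [Fintype m] [Fintype n]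
    (s : Finset ι) (M : ι → Matrix m n K) : (∑ i ∈ s, M i).rank ≤ ∑ i ∈ s, (M i).rank := by
  classical
  induction s using Finset.induction_on with
  | empty => simp
  | insert a s ha ih =>
    rw [Finset.sum_insert ha, Finset.sum_insert ha]
    refine le_trans ?_ (Nat.add_le_add_left ih _)
    have h : LinearMap.range (M a + ∑ i ∈ s, M i).mulVecLin ≤
        LinearMap.range (M a).mulVecLin ⊔ LinearMap.range (∑ i ∈ s, M i).mulVecLin := by
      rw [Matrix.mulVecLin_add]
      exact LinearMap.range_add_le _ _
    exact (Submodule.finrank_mono h).trans (Submodule.finrank_add_le_finrank_add_finrank _ _)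

theorem exists_colIdx_eq {a b : ℕ} (c : Fin (a * b)) :
    ∃ (j : Fin a) (k : Fin b), colIdx j k = c := by
  have ha : 0 < a := Nat.pos_of_ne_zero (by rintro rfl; simpa using c.isLt)
  refine ⟨⟨c % a, Nat.mod_lt _ ha⟩, ⟨c / a, Nat.div_lt_of_lt_mul c.isLt⟩, Fin.ext ?_⟩
  exact Nat.div_add_mod' _ _

theorem IsPrimitiveRoot.sum_pow_mul_inv_pow {K : Type*} [Field K] {n : ℕ} {ζ : K}
    (hζ : IsPrimitiveRoot ζ n) (l l' : Fin n) :
    ∑ k : Fin n, ζ ^ ((l : ℕ) * k) * ζ⁻¹ ^ ((l' : ℕ) * k) = if l = l' then (n : K) else 0 := by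
  have hn : n ≠ 0 := l.pos.ne'
  have h0 : ζ ≠ 0 := hζ.ne_zero hn
  have hterm : ∀ k : Fin n,
      ζ ^ ((l : ℕ) * k) * ζ⁻¹ ^ ((l' : ℕ) * k) = (ζ ^ (l : ℕ) / ζ ^ (l' : ℕ)) ^ (k : ℕ) := by
    intro k
    rw [div_pow, ← pow_mul, ← pow_mul, inv_pow, div_eq_mul_inv]
  simp only [hterm]
  split_ifs with h
  · subst h
    simp [div_self (pow_ne_zero _ h0)]
  · have hne : ζ ^ (l : ℕ) / ζ ^ (l' : ℕ) ≠ 1 := by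
      rw [Ne, div_eq_one_iff_eq (pow_ne_zero _ h0)]
      exact fun hp => h (Fin.ext (hζ.pow_inj l.isLt l'.isLt hp))
    rw [Fin.sum_univ_eq_sum_range (fun k => (ζ ^ (l : ℕ) / ζ ^ (l' : ℕ)) ^ k),
      geom_sum_eq hne, div_pow, ← pow_mul, ← pow_mul, mul_comm (l : ℕ), mul_comm (l' : ℕ),
      pow_mul, pow_mul, hζ.pow_eq_one]
    simp

theorem isPrimitiveRoot_exp_neg {n : ℕ} (hn : n ≠ 0) :
    IsPrimitiveRoot (Complex.exp (-(2 * (Real.pi : ℂ) * Complex.I) / (n : ℂ))) n := by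
  rw [neg_div, Complex.exp_neg]
  exact (Complex.isPrimitiveRoot_exp n hn).inv

/-- Fourier inversion: a tensor is recovered from its Fourier slices. -/
theorem sum_fourierSlice_mul_inv_pow {n1 n2 n3 : ℕ} (T : Fin n1 → Fin n2 → Fin n3 → ℝ)
    (i : Fin n1) (j : Fin n2) (l : Fin n3) :
    ∑ k : Fin n3, fourierSlice T k i j *
        (Complex.exp (-(2 * (Real.pi : ℂ) * Complex.I) / (n3 : ℂ)))⁻¹ ^ ((l : ℕ) * (k : ℕ)) =
      n3 * (T i j l : ℂ) := by
  have hζ := isPrimitiveRoot_exp_neg l.pos.ne'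
  simp only [fourierSlice, Matrix.of_apply, Finset.sum_mul]
  rw [Finset.sum_comm]
  simp only [mul_right_comm _ ((T i j _ : ℝ) : ℂ), ← Finset.sum_mul, hζ.sum_pow_mul_inv_pow]
  simp

section Reshape

variable {n1 n2 n3 : ℕ} {X : Matrix (Fin n1) (Fin (n2 * n3)) ℝ}
  {T : Fin n1 → Fin n2 → Fin n3 → ℝ}

theorem fourierSlice_rank_le (hT : ∀ i j k, T i j k = X i (colIdx j k)) (k : Fin n3) :
    (fourierSlice T k).rank ≤ X.rank := by
  have h : fourierSlice T k = ∑ l : Fin n3, X.map Complex.ofRealHom *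
      (Matrix.of fun c j => if c = colIdx j l then
        Complex.exp (-(2 * (Real.pi : ℂ) * Complex.I) / (n3 : ℂ)) ^ ((l : ℕ) * (k : ℕ)) else 0 :
          Matrix (Fin (n2 * n3)) (Fin n2) ℂ) := by
    ext i j
    simp [fourierSlice, Matrix.sum_apply, Matrix.mul_apply, hT, mul_comm]
  rw [h, ← Matrix.mul_sum, ← Matrix.rank_map_ringHom Complex.ofRealHom X]
  exact Matrix.rank_mul_le_left _ _

theorem rank_le_sum_fourierSlice_rank (hT : ∀ i j k, T i j k = X i (colIdx j k)) :
    X.rank ≤ ∑ k, (fourierSlice T k).rank := by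
  choose J L hJL using exists_colIdx_eq (a := n2) (b := n3)
  have h : X.map Complex.ofRealHom = ∑ k : Fin n3, fourierSlice T k *
      Matrix.of fun j c => if j = J c then (n3 : ℂ)⁻¹ *
        (Complex.exp (-(2 * (Real.pi : ℂ) * Complex.I) / (n3 : ℂ)))⁻¹ ^
          ((L c : ℕ) * (k : ℕ)) else 0 := by
    ext i c
    have hn : (n3 : ℂ) ≠ 0 := Nat.cast_ne_zero.2 (L c).pos.ne'
    simp only [Matrix.sum_apply, Matrix.mul_apply, Matrix.of_apply, mul_ite, mul_zero,
      Finset.sum_ite_eq', Finset.mem_univ, if_true, Matrix.map_apply]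
    simp only [mul_left_comm _ (n3 : ℂ)⁻¹, ← Finset.mul_sum, sum_fourierSlice_mul_inv_pow]
    rw [inv_mul_cancel_left₀ hn, hT, hJL]
    rfl
  rw [← Matrix.rank_map_ringHom Complex.ofRealHom X, h]
  exact (Matrix.rank_sum_le _ _).trans
    (Finset.sum_le_sum fun k _ => Matrix.rank_mul_le_left _ _)

end Reshape

/-- for `X ∈ ℝ^{n1×h}` with `h = n2·n3` and the reshaped tensor
`𝒳 ∈ ℝ^{n1×n2×n3}` with `𝒳(i,j,k) = X(i, (k−1)n2 + j)`, one has
`rank_t(𝒳) ≤ rank(X) ≤ n3 · rank_t(𝒳)`. -/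
theorem tubalRank_reshape_bounds (n1 n2 n3 : ℕ)
    (X : Matrix (Fin n1) (Fin (n2 * n3)) ℝ)
    (T : Fin n1 → Fin n2 → Fin n3 → ℝ)
    (hT : ∀ (i : Fin n1) (j : Fin n2) (k : Fin n3), T i j k = X i (colIdx j k)) :
    tubalRank T ≤ X.rank ∧ X.rank ≤ n3 * tubalRank T := by
  refine ⟨Finset.sup_le fun k _ => fourierSlice_rank_le hT k,
    (rank_le_sum_fourierSlice_rank hT).trans ?_⟩
  calc ∑ k, (fourierSlice T k).rank ≤ ∑ _k : Fin n3, tubalRank T :=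
        Finset.sum_le_sum fun k _ =>
          Finset.le_sup (f := fun k => (fourierSlice T k).rank) (Finset.mem_univ k)
    _ = n3 * tubalRank T := by simp
end

section
/- Let X ∈ ℝ^{n1×h} with h = n2·n3 and let 𝒳 ∈ ℝ^{n1×n2×n3} be the tensor obtained by reshaping X, i.e., 𝒳(i,j,k) = X(i, (k−1)n2 + j). Then rank(X) ≤ Σ_{k=1}^{n3} rank(X̄^{(k)}) ≤ n3 · rank(X), where X̄^{(k)} are the Fourier slices of 𝒳 (the left-hand quantity Σ_k rank(X̄^{(k)}) is the ℓ1 norm of the multi-rank of 𝒳). -/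
namespace Matrix

/-- Rank factorization together with one-sided inverses of the factors. -/
theorem exists_rank_factorization_s8 {m n K : Type*} [Fintype m] [DecidableEq m] [Fintype n]
    [DecidableEq n] [Field K] (A : Matrix m n K) :
    ∃ (B : Matrix m (Fin A.rank) K) (C : Matrix (Fin A.rank) n K)
      (P : Matrix (Fin A.rank) m K) (Q : Matrix n (Fin A.rank) K),
      A = B * C ∧ P * A * Q = 1 := by
  let e : LinearMap.range A.mulVecLin ≃ₗ[K] (Fin A.rank → K) :=
    (Module.finBasis K (LinearMap.range A.mulVecLin)).equivFun
  let f : (Fin A.rank → K) →ₗ[K] (m → K) :=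
    (LinearMap.range A.mulVecLin).subtype ∘ₗ e.symm.toLinearMap
  let g : (n → K) →ₗ[K] (Fin A.rank → K) := e.toLinearMap ∘ₗ A.mulVecLin.rangeRestrict
  have hfg : f ∘ₗ g = A.mulVecLin := by
    ext; simp [f, g]
  have hf : LinearMap.ker f = ⊥ :=
    LinearMap.ker_eq_bot.2 (Subtype.val_injective.comp e.symm.injective)
  have hg : LinearMap.range g = ⊤ :=
    LinearMap.range_eq_top.2 (e.surjective.comp A.mulVecLin.surjective_rangeRestrict)
  obtain ⟨p, hp⟩ := f.exists_leftInverse_of_injective hf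
  obtain ⟨q, hq⟩ := g.exists_rightInverse_of_surjective hg
  have hA : A = LinearMap.toMatrix' f * LinearMap.toMatrix' g := by
    rw [← LinearMap.toMatrix'_comp, hfg, ← Matrix.toLin'_apply', LinearMap.toMatrix'_toLin']
  refine ⟨LinearMap.toMatrix' f, LinearMap.toMatrix' g, LinearMap.toMatrix' p,
    LinearMap.toMatrix' q, hA, ?_⟩
  have hp' := congrArg LinearMap.toMatrix' hp
  have hq' := congrArg LinearMap.toMatrix' hq
  rw [LinearMap.toMatrix'_comp, LinearMap.toMatrix'_id] at hp' hq'
  generalize LinearMap.toMatrix' f = B at *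
  generalize LinearMap.toMatrix' g = C at *
  calc LinearMap.toMatrix' p * A * LinearMap.toMatrix' q
      = LinearMap.toMatrix' p * (B * C) * LinearMap.toMatrix' q := by rw [← hA]
    _ = (LinearMap.toMatrix' p * B) * (C * LinearMap.toMatrix' q) := by
      simp only [Matrix.mul_assoc]
    _ = 1 := by rw [hp', hq', Matrix.mul_one]

/-- The rank of a matrix is invariant under field extension. -/
theorem rank_map_ringHom_s8 {m n K L : Type*} [Fintype m] [Fintype n] [Field K] [Field L]
    (A : Matrix m n K) (φ : K →+* L) : (A.map φ).rank = A.rank := by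
  classical
  obtain ⟨B, C, P, Q, hBC, hPQ⟩ := A.exists_rank_factorization_s8
  apply le_antisymm
  · calc (A.map φ).rank = (B.map φ * C.map φ).rank := by
          rw [← Matrix.map_mul, ← hBC]
      _ ≤ (B.map φ).rank := rank_mul_le_left _ _
      _ ≤ A.rank := (rank_le_card_width _).trans_eq (Fintype.card_fin _)
  · have h : P.map φ * A.map φ * Q.map φ = 1 := by
      rw [← Matrix.map_mul, ← Matrix.map_mul, hPQ, Matrix.map_one _ (map_zero φ) (map_one φ)]
    calc A.rank = (P.map φ * A.map φ * Q.map φ).rank := by rw [h, rank_one, Fintype.card_fin]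
      _ ≤ (P.map φ * A.map φ).rank := rank_mul_le_left _ _
      _ ≤ (A.map φ).rank := rank_mul_le_right _ _

end Matrix

theorem Submodule.finrank_finset_sup_le {ι K V : Type*} [Field K] [AddCommGroup V] [Module K V]
    [FiniteDimensional K V] (s : Finset ι) (W : ι → Submodule K V) :
    Module.finrank K (s.sup W : Submodule K V) ≤ ∑ i ∈ s, Module.finrank K (W i) := by
  classical
  induction s using Finset.induction_on with
  | empty => simp
  | insert a s ha ih =>
    rw [Finset.sup_insert, Finset.sum_insert ha]
    exact (Submodule.finrank_add_le_finrank_add_finrank _ _).trans (by gcongr)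

theorem IsPrimitiveRoot.sum_fin_inv_pow_mul_pow {K : Type*} [Field K] {n : ℕ} {w : K}
    (hw : IsPrimitiveRoot w n) (l m : Fin n) :
    ∑ k : Fin n, (w ^ ((l : ℕ) * (k : ℕ)))⁻¹ * w ^ ((m : ℕ) * (k : ℕ)) =
      if m = l then (n : K) else 0 := by
  have hw0 : w ≠ 0 := hw.ne_zero (Nat.ne_zero_of_lt l.isLt)
  have hpow (k : Fin n) : (w ^ ((l : ℕ) * (k : ℕ)))⁻¹ * w ^ ((m : ℕ) * (k : ℕ)) =
      (w ^ (m : ℕ) / w ^ (l : ℕ)) ^ (k : ℕ) := by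
    rw [pow_mul, pow_mul, div_pow, div_eq_inv_mul]
  simp_rw [hpow]
  rw [Fin.sum_univ_eq_sum_range fun k => (w ^ (m : ℕ) / w ^ (l : ℕ)) ^ k]
  split_ifs with h
  · subst h
    simp [div_self (pow_ne_zero _ hw0)]
  · have hne : w ^ (m : ℕ) / w ^ (l : ℕ) ≠ 1 := fun h1 =>
      h (Fin.ext (hw.pow_inj m.isLt l.isLt ((div_eq_one_iff_eq (pow_ne_zero _ hw0)).1 h1)))
    rw [geom_sum_eq hne, div_pow, ← pow_mul, ← pow_mul, mul_comm, pow_mul, mul_comm (l : ℕ),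
      pow_mul, hw.pow_eq_one]
    simp

/-- Fourier inversion for the slices of a tensor. -/
theorem sum_inv_pow_mul_fourierSlice {n1 n2 n3 : ℕ} (A : Fin n1 → Fin n2 → Fin n3 → ℝ)
    (i : Fin n1) (j : Fin n2) (l : Fin n3) :
    ∑ k : Fin n3,
      (Complex.exp (-(2 * (Real.pi : ℂ) * Complex.I) / (n3 : ℂ)) ^ ((l : ℕ) * (k : ℕ)))⁻¹ *
        fourierSlice A k i j = n3 * (A i j l : ℂ) := by
  have hw := isPrimitiveRoot_exp_neg (Nat.ne_zero_of_lt l.isLt)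
  simp only [fourierSlice, Matrix.of_apply, Finset.mul_sum, ← mul_assoc]
  rw [Finset.sum_comm]
  simp [← Finset.sum_mul, hw.sum_fin_inv_pow_mul_pow]

/-- for `X ∈ ℝ^{n1×h}` with `h = n2·n3` and the reshaped tensor
`𝒳 ∈ ℝ^{n1×n2×n3}` with `𝒳(i,j,k) = X(i, (k−1)n2 + j)`, one has
`rank(X) ≤ Σ_{k=1}^{n3} rank(X̄^{(k)}) ≤ n3 · rank(X)`, where the middle quantity is
the ℓ1 norm of the multi-rank of `𝒳`. -/
theorem multiRank_l1_reshape_bounds (n1 n2 n3 : ℕ)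
    (X : Matrix (Fin n1) (Fin (n2 * n3)) ℝ)
    (T : Fin n1 → Fin n2 → Fin n3 → ℝ)
    (hT : ∀ (i : Fin n1) (j : Fin n2) (k : Fin n3), T i j k = X i (colIdx j k)) :
    X.rank ≤ (∑ k : Fin n3, (fourierSlice T k).rank) ∧
      (∑ k : Fin n3, (fourierSlice T k).rank) ≤ n3 * X.rank := by
  let Y : Matrix (Fin n1) (Fin (n2 * n3)) ℂ := X.map Complex.ofRealHom
  have hY : Y.rank = X.rank := X.rank_map_ringHom_s8 Complex.ofRealHom
  rw [← hY]
  constructor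
  · have hspan : Submodule.span ℂ (Set.range Y.col) ≤
        Finset.univ.sup fun k => Submodule.span ℂ (Set.range (fourierSlice T k).col) := by
      rw [Submodule.span_le]
      rintro _ ⟨c, rfl⟩
      obtain ⟨j, l, rfl⟩ := exists_colIdx_eq c
      have hn : (n3 : ℂ) ≠ 0 := Nat.cast_ne_zero.2 (Nat.ne_zero_of_lt l.isLt)
      have hcol : Y.col (colIdx j l) = (n3 : ℂ)⁻¹ • ∑ k : Fin n3,
          (Complex.exp (-(2 * (Real.pi : ℂ) * Complex.I) / (n3 : ℂ)) ^
            ((l : ℕ) * (k : ℕ)))⁻¹ • (fourierSlice T k).col j := by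
        ext i
        simp only [Pi.smul_apply, Finset.sum_apply, Matrix.col_apply, smul_eq_mul,
          sum_inv_pow_mul_fourierSlice, inv_mul_cancel_left₀ hn, hT]
        rfl
      rw [hcol]
      refine Submodule.smul_mem _ _ (Submodule.sum_mem _ fun k _ => Submodule.smul_mem _ _ ?_)
      exact Finset.le_sup
        (f := fun k => Submodule.span ℂ (Set.range (fourierSlice T k).col)) (Finset.mem_univ k)
        (Submodule.subset_span ⟨j, rfl⟩)
    simp only [Matrix.rank_eq_finrank_span_cols]
    exact (Submodule.finrank_mono hspan).trans (Submodule.finrank_finset_sup_le _ _)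
  · have hslice (k : Fin n3) : (fourierSlice T k).rank ≤ Y.rank := by
      rw [Matrix.rank_eq_finrank_span_cols, Matrix.rank_eq_finrank_span_cols]
      refine Submodule.finrank_mono (Submodule.span_le.2 ?_)
      rintro _ ⟨j, rfl⟩
      have hcol : (fourierSlice T k).col j = ∑ l : Fin n3,
          Complex.exp (-(2 * (Real.pi : ℂ) * Complex.I) / (n3 : ℂ)) ^ ((l : ℕ) * (k : ℕ)) •
            Y.col (colIdx j l) := by
        ext i
        simp [fourierSlice, Y, hT]
      rw [hcol]
      exact Submodule.sum_mem _ fun l _ =>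
        Submodule.smul_mem _ _ (Submodule.subset_span ⟨colIdx j l, rfl⟩)
    simpa using Finset.sum_le_sum fun k (_ : k ∈ Finset.univ) => hslice k
end

section
/- Let 𝒳 ∈ ℝ^{n1×n2×n3}, let X_{(3)} ∈ ℝ^{n3×n1n2} be its mode-3 unfolding, let p, q be positive integers with pq = n1n2, and let 𝒳̃ ∈ ℝ^{n3×p×q} be the tensor obtained by reshaping X_{(3)}, i.e., 𝒳̃(a, s, t) = X_{(3)}(a, (t−1)p + s). Then rank_t(𝒳̃) ≤ rank(X_{(3)}) ≤ q · rank_t(𝒳̃). -/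
/-- Extension of scalars between fields preserves the rank of a matrix. -/
theorem Matrix.rank_map_algebraMap {K L m n : Type*} [Field K] [Field L] [Algebra K L]
    [Fintype m] [Fintype n] (A : Matrix m n K) :
    (A.map (algebraMap K L)).rank = A.rank := by
  obtain ⟨κ, a, ha, hspan, hli⟩ := exists_linearIndependent' K A.col
  have : Fintype κ := Fintype.ofInjective a ha
  have hli' : LinearIndependent L ((A.map (algebraMap K L)).col ∘ a) :=
    linearIndependent_algebraMap_comp_iff.mpr hli
  have hspan' : Submodule.span L (Set.range ((A.map (algebraMap K L)).col ∘ a)) =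
      Submodule.span L (Set.range (A.map (algebraMap K L)).col) := by
    refine le_antisymm (Submodule.span_mono (Set.range_comp_subset_range _ _))
      (Submodule.span_le.mpr ?_)
    rintro _ ⟨j, rfl⟩
    have hj : A.col j ∈ Submodule.span K (Set.range (A.col ∘ a)) :=
      hspan ▸ Submodule.subset_span ⟨j, rfl⟩
    obtain ⟨c, hc⟩ := (Submodule.mem_span_range_iff_exists_fun K).mp hj
    refine (Submodule.mem_span_range_iff_exists_fun L).mpr ⟨fun i => algebraMap K L (c i), ?_⟩
    ext i
    have hi := congrArg (algebraMap K L) (congrFun hc i)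
    simpa [Finset.sum_apply, Algebra.smul_def] using hi
  rw [Matrix.rank_eq_finrank_span_cols, Matrix.rank_eq_finrank_span_cols, ← hspan, ← hspan',
    finrank_span_eq_card hli, finrank_span_eq_card hli']

theorem Matrix.rank_add_le_rank_add_rank {K m n : Type*} [Field K] [Fintype m] [Fintype n]
    (A B : Matrix m n K) : (A + B).rank ≤ A.rank + B.rank := by
  rw [Matrix.rank, Matrix.rank, Matrix.rank, Matrix.mulVecLin_add]
  refine (Submodule.finrank_mono ?_).trans (Submodule.finrank_add_le_finrank_add_finrank _ _)
  exact LinearMap.range_add_le _ _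

theorem Matrix.rank_sum_le_sum_rank {K m n ι : Type*} [Field K] [Fintype m] [Fintype n]
    (s : Finset ι) (A : ι → Matrix m n K) : (∑ i ∈ s, A i).rank ≤ ∑ i ∈ s, (A i).rank :=
  Finset.le_sum_of_subadditive _ (by simp) Matrix.rank_add_le_rank_add_rank s A

/-- Orthogonality of the characters of the discrete Fourier transform of length `q`. -/
theorem sum_exp_pow_mul_exp_pow {q : ℕ} (t l : Fin q) :
    ∑ k : Fin q, Complex.exp (2 * (Real.pi : ℂ) * Complex.I / (q : ℂ)) ^ ((t : ℕ) * (k : ℕ)) *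
      Complex.exp (-(2 * (Real.pi : ℂ) * Complex.I) / (q : ℂ)) ^ ((l : ℕ) * (k : ℕ)) =
    if l = t then (q : ℂ) else 0 := by
  have hq : q ≠ 0 := (Fin.pos t).ne'
  have hζ := Complex.isPrimitiveRoot_exp q hq
  rw [neg_div, Complex.exp_neg]
  set ζ := Complex.exp (2 * (Real.pi : ℂ) * Complex.I / (q : ℂ))
  have hζ0 : ζ ≠ 0 := Complex.exp_ne_zero _
  simp only [pow_mul, ← mul_pow]
  split_ifs with h
  · subst h
    simp [hζ0]
  · set x := ζ ^ (t : ℕ) * ζ⁻¹ ^ (l : ℕ)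
    have hx1 : x ≠ 1 := by
      intro hx
      refine h (Fin.ext (hζ.pow_inj l.isLt t.isLt ?_))
      calc ζ ^ (l : ℕ) = x * ζ ^ (l : ℕ) := by rw [hx, one_mul]
        _ = ζ ^ (t : ℕ) := by simp [x, hζ0]
    have hxq : x ^ q = 1 := by
      simp only [x, mul_pow, ← pow_mul, mul_comm _ q, inv_pow]
      simp [pow_mul, hζ.pow_eq_one]
    rw [Fin.sum_univ_eq_sum_range (fun k => x ^ k) q, geom_sum_eq hx1, hxq, sub_self, zero_div]

/-- Each Fourier slice of a reshaping of `X` has rank at most that of `X`. -/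
theorem rank_fourierSlice_le {m p q : ℕ} {ι : Type*} [Fintype ι]
    (X : Matrix (Fin m) ι ℝ) (e : Fin p → Fin q → ι) (k : Fin q) :
    (fourierSlice (fun a s t => X a (e s t)) k).rank ≤ X.rank := by
  classical
  let W : Matrix ι (Fin p) ℂ := Matrix.of fun c s => ∑ t : Fin q, if c = e s t then
    Complex.exp (-(2 * (Real.pi : ℂ) * Complex.I) / (q : ℂ)) ^ ((t : ℕ) * (k : ℕ)) else 0
  have hW : fourierSlice (fun a s t => X a (e s t)) k = X.map (algebraMap ℝ ℂ) * W := by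
    ext a s
    simp only [fourierSlice, W, Matrix.mul_apply, Matrix.of_apply, Matrix.map_apply,
      Finset.mul_sum]
    rw [Finset.sum_comm]
    simp [mul_comm]
  rw [hW, ← Matrix.rank_map_algebraMap (L := ℂ) X]
  exact Matrix.rank_mul_le_left _ _

/-- If every column of `X` occurs in the reshaping of `X`, then the rank of `X` is at most the
sum of the ranks of the Fourier slices. -/
theorem rank_le_sum_rank_fourierSlice {m p q : ℕ} {ι : Type*} [Fintype ι]
    (X : Matrix (Fin m) ι ℝ) (e : Fin p → Fin q → ι) (he : ∀ c, ∃ s t, e s t = c) :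
    X.rank ≤ ∑ k : Fin q, (fourierSlice (fun a s t => X a (e s t)) k).rank := by
  choose s t hst using he
  let M (k : Fin q) : Matrix (Fin p) ι ℂ := Matrix.of fun r c => if r = s c then
    (q : ℂ)⁻¹ * Complex.exp (2 * (Real.pi : ℂ) * Complex.I / (q : ℂ)) ^ ((t c : ℕ) * (k : ℕ))
    else 0
  have hM : X.map (algebraMap ℝ ℂ) =
      ∑ k, fourierSlice (fun a s t => X a (e s t)) k * M k := by
    ext a c
    have hq : (q : ℂ) ≠ 0 := Nat.cast_ne_zero.mpr (Fin.pos (t c)).ne'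
    have hk (k : Fin q) : (fourierSlice (fun a s t => X a (e s t)) k * M k) a c =
        ∑ l : Fin q, (q : ℂ)⁻¹ * (X a (e (s c) l) : ℂ) *
          (Complex.exp (2 * (Real.pi : ℂ) * Complex.I / (q : ℂ)) ^ ((t c : ℕ) * (k : ℕ)) *
          Complex.exp (-(2 * (Real.pi : ℂ) * Complex.I) / (q : ℂ)) ^ ((l : ℕ) * (k : ℕ))) := by
      simp only [M, fourierSlice, Matrix.mul_apply, Matrix.of_apply, mul_ite, mul_zero,
        Finset.sum_ite_eq', Finset.mem_univ, if_true, Finset.sum_mul]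
      exact Finset.sum_congr rfl fun l _ => by ring
    simp only [Matrix.sum_apply, hk]
    rw [Finset.sum_comm]
    simp only [← Finset.mul_sum, sum_exp_pow_mul_exp_pow, mul_ite, mul_zero,
      Finset.sum_ite_eq', Finset.mem_univ, if_true, hst, Matrix.map_apply]
    simp only [Complex.coe_algebraMap]
    field_simp
  rw [← Matrix.rank_map_algebraMap (L := ℂ) X, hM]
  exact (Matrix.rank_sum_le_sum_rank _ _).trans
    (Finset.sum_le_sum fun k _ => Matrix.rank_mul_le_left _ _)

/-- for a tensor `𝒳 ∈ ℝ^{n1×n2×n3}` with mode-3 unfolding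
`X_{(3)} ∈ ℝ^{n3×n1n2}` (entries `X_{(3)}(i3, i1+(i2−1)n1) = 𝒳(i1,i2,i3)`), positive
`p, q` with `pq = n1n2`, and the reshaped tensor `𝒳̃ ∈ ℝ^{n3×p×q}` with
`𝒳̃(a,s,t) = X_{(3)}(a, (t−1)p + s)`, one has
`rank_t(𝒳̃) ≤ rank(X_{(3)}) ≤ q · rank_t(𝒳̃)`. -/
theorem tubalRank_mode3_reshape_bounds (n1 n2 n3 p q : ℕ)
    (hp : 0 < p) (hq : 0 < q) (hpq : p * q = n1 * n2)
    (T : Fin n1 → Fin n2 → Fin n3 → ℝ)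
    (X3 : Matrix (Fin n3) (Fin (n1 * n2)) ℝ)
    (hX3 : ∀ (i1 : Fin n1) (i2 : Fin n2) (i3 : Fin n3),
      X3 i3 (colIdx i1 i2) = T i1 i2 i3)
    (Ttil : Fin n3 → Fin p → Fin q → ℝ)
    (hTtil : ∀ (a : Fin n3) (s : Fin p) (t : Fin q),
      Ttil a s t = X3 a (Fin.cast hpq (colIdx s t))) :
    tubalRank Ttil ≤ X3.rank ∧ X3.rank ≤ q * tubalRank Ttil := by
  obtain rfl : Ttil = fun a s t => X3 a (Fin.cast hpq (colIdx s t)) := by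
    funext a s t
    exact hTtil a s t
  refine ⟨Finset.sup_le fun k _ => rank_fourierSlice_le X3 _ k, ?_⟩
  refine (rank_le_sum_rank_fourierSlice X3 (fun s t => Fin.cast hpq (colIdx s t)) ?_).trans ?_
  · intro c
    obtain ⟨s, t, h⟩ := exists_colIdx_eq (Fin.cast hpq.symm c)
    exact ⟨s, t, by simp [h]⟩
  · calc _ ≤ Finset.univ.card • tubalRank fun a s t => X3 a (Fin.cast hpq (colIdx s t)) :=
          Finset.sum_le_card_nsmul _ _ _ fun k hk =>
            Finset.le_sup (f := fun k : Fin q => (fourierSlice _ k).rank) hk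
      _ = _ := by rw [Finset.card_univ, Fintype.card_fin, smul_eq_mul]
end

section
/- Let X ∈ ℂ^{m×n}, P, P' ∈ ℂ^{m×r}, and Q, Q' ∈ ℂ^{r×n} satisfy the normal equations (P'Q − X)Q* = 0 and (P')*(P'Q' − X) = 0, together with P'(Q − Q')Q* = 0 (where * denotes conjugate transpose). Then ‖PQ − X‖_F² − ‖P'Q' − X‖_F² = ‖P'Q' − PQ‖_F². In particular ‖PQ − X‖_F² ≥ ‖P'Q' − X‖_F² + ‖P'Q' − PQ‖_F². -/
open Matrix

/-- Squared Frobenius norm `‖A‖_F² = Σ_{i,j} |A_{ij}|²`. -/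
noncomputable def frobSq {m n : ℕ} (A : Matrix (Fin m) (Fin n) ℂ) : ℝ :=
  ∑ i : Fin m, ∑ j : Fin n, Complex.normSq (A i j)

theorem ofReal_frobSq {m n : ℕ} (A : Matrix (Fin m) (Fin n) ℂ) :
    (frobSq A : ℂ) = (Aᴴ * A).trace := by
  simp only [frobSq, Matrix.trace, Matrix.diag_apply, Matrix.mul_apply,
    Matrix.conjTranspose_apply, Complex.ofReal_sum, Complex.normSq_eq_conj_mul_self,
    Complex.star_def]
  exact Finset.sum_comm

/-- The Pythagorean theorem for the Frobenius inner product. -/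
theorem frobSq_sub_of_trace_eq_zero {m n : ℕ} {A B : Matrix (Fin m) (Fin n) ℂ}
    (h : (Bᴴ * A).trace = 0) : frobSq (A - B) = frobSq A + frobSq B := by
  have h' : (Aᴴ * B).trace = 0 := by
    rw [← star_eq_zero, ← Matrix.trace_conjTranspose, Matrix.conjTranspose_mul,
      Matrix.conjTranspose_conjTranspose, h]
  apply Complex.ofReal_injective
  simp only [Complex.ofReal_add, ofReal_frobSq, Matrix.conjTranspose_sub, Matrix.sub_mul,
    Matrix.mul_sub, Matrix.trace_sub, h, h']
  ring

/-- if `(P'Q − X)Q* = 0`, `(P')*(P'Q' − X) = 0`, and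
`P'(Q − Q')Q* = 0`, then `‖PQ − X‖_F² − ‖P'Q' − X‖_F² = ‖P'Q' − PQ‖_F²`; in
particular `‖PQ − X‖_F² ≥ ‖P'Q' − X‖_F² + ‖P'Q' − PQ‖_F²`. -/
theorem als_normal_equations_descent (m n r : ℕ)
    (X : Matrix (Fin m) (Fin n) ℂ)
    (P P' : Matrix (Fin m) (Fin r) ℂ) (Q Q' : Matrix (Fin r) (Fin n) ℂ)
    (h1 : (P' * Q - X) * Qᴴ = 0)
    (h2 : P'ᴴ * (P' * Q' - X) = 0)
    (h3 : P' * (Q - Q') * Qᴴ = 0) :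
    frobSq (P * Q - X) - frobSq (P' * Q' - X) = frobSq (P' * Q' - P * Q) ∧
      frobSq (P' * Q' - X) + frobSq (P' * Q' - P * Q) ≤ frobSq (P * Q - X) := by
  have hE : (P' * Q' - X) * Qᴴ = 0 := by
    have h : (P' * Q' - X) * Qᴴ = (P' * Q - X) * Qᴴ - P' * (Q - Q') * Qᴴ := by
      rw [← Matrix.sub_mul, Matrix.mul_sub]
      congr 1
      abel
    rw [h, h1, h3, sub_zero]
  have horth : ((P' * Q' - P * Q)ᴴ * (P' * Q' - X)).trace = 0 := by
    rw [Matrix.conjTranspose_sub, Matrix.sub_mul, Matrix.conjTranspose_mul,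
      Matrix.conjTranspose_mul, Matrix.mul_assoc, h2, Matrix.mul_zero, Matrix.mul_assoc,
      Matrix.trace_sub, Matrix.trace_mul_comm Qᴴ, Matrix.mul_assoc, hE, Matrix.mul_zero]
    simp
  have hpyth := frobSq_sub_of_trace_eq_zero horth
  rw [sub_sub_sub_cancel_left] at hpyth
  constructor <;> linarith
end

section
/- Let M ∈ ℂ^{m×n}, Ω ⊆ [m]×[n], and X ∈ ℂ^{m×n} with P_Ω(X − M) = 0. Let P, P' ∈ ℂ^{m×r} and Q, Q' ∈ ℂ^{r×n} satisfy (P'Q − X)Q* = 0, (P')*(P'Q' − X) = 0, and P'(Q − Q')Q* = 0, and set X' = P_{Ω^c}(P'Q') + P_Ω(M). Then the objective g(P,Q,X) = ½‖PQ − X‖_F² monotonically decreases along the update, with the quantitative bound g(P,Q,X) − g(P',Q',X') ≥ ½‖P'Q' − PQ‖_F² ≥ 0. -/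
open Matrix

/-- `P_Ω(X)`: the matrix agreeing with `X` on the entries indexed by `Ω` and zero
elsewhere. -/
def projOn {m n : ℕ} (Ω : Finset (Fin m × Fin n)) (X : Matrix (Fin m) (Fin n) ℂ) :
    Matrix (Fin m) (Fin n) ℂ :=
  Matrix.of fun i j => if (i, j) ∈ Ω then X i j else 0

theorem frobSq_nonneg {m n : ℕ} (A : Matrix (Fin m) (Fin n) ℂ) : 0 ≤ frobSq A :=
  Finset.sum_nonneg fun _ _ => Finset.sum_nonneg fun _ _ => Complex.normSq_nonneg _

theorem frobSq_neg {m n : ℕ} (A : Matrix (Fin m) (Fin n) ℂ) : frobSq (-A) = frobSq A := by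
  simp [frobSq]

/-- Pythagoras for the Frobenius norm. -/
theorem frobSq_add_of_trace_eq_zero {m n : ℕ} (A B : Matrix (Fin m) (Fin n) ℂ)
    (h : (A * Bᴴ).trace = 0) : frobSq (A + B) = frobSq A + frobSq B := by
  have hre : ∑ i, ∑ j, (A i j * star (B i j)).re = 0 := by
    simpa [Matrix.trace, Matrix.mul_apply] using congrArg Complex.re h
  simp only [frobSq, Matrix.add_apply, Complex.normSq_add, Finset.sum_add_distrib,
    ← Finset.mul_sum]
  simp only [starRingEnd_apply, hre, mul_zero, add_zero]

/-- If `X` agrees with `M` on `Ω`, then filling in `Y` off `Ω` is at least as close to `Y`. -/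
theorem frobSq_sub_projOn_le {m n : ℕ} (Ω : Finset (Fin m × Fin n))
    (M X Y : Matrix (Fin m) (Fin n) ℂ) (hX : projOn Ω (X - M) = 0) :
    frobSq (Y - (projOn Ωᶜ Y + projOn Ω M)) ≤ frobSq (Y - X) := by
  refine Finset.sum_le_sum fun i _ => Finset.sum_le_sum fun j _ => ?_
  by_cases hij : (i, j) ∈ Ω
  · have hXM : X i j = M i j := by
      simpa [projOn, hij, sub_eq_zero] using congrFun (congrFun hX i) j
    simp [projOn, hij, hXM]
  · simpa [projOn, hij] using Complex.normSq_nonneg (Y i j - X i j)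

/-- with `P_Ω(X − M) = 0`, the ALS normal equations
`(P'Q − X)Q* = 0`, `(P')*(P'Q' − X) = 0`, `P'(Q − Q')Q* = 0`, and
`X' = P_{Ω^c}(P'Q') + P_Ω(M)`, the objective `g(P,Q,X) = ½‖PQ − X‖_F²`
monotonically decreases:
`g(P,Q,X) − g(P',Q',X') ≥ ½‖P'Q' − PQ‖_F² ≥ 0`. -/
theorem tctfm_objective_decrease (m n r : ℕ)
    (M : Matrix (Fin m) (Fin n) ℂ) (Ω : Finset (Fin m × Fin n))
    (X : Matrix (Fin m) (Fin n) ℂ) (hX : projOn Ω (X - M) = 0)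
    (P P' : Matrix (Fin m) (Fin r) ℂ) (Q Q' : Matrix (Fin r) (Fin n) ℂ)
    (h1 : (P' * Q - X) * Qᴴ = 0)
    (h2 : P'ᴴ * (P' * Q' - X) = 0)
    (h3 : P' * (Q - Q') * Qᴴ = 0)
    (X' : Matrix (Fin m) (Fin n) ℂ)
    (hX' : X' = projOn Ωᶜ (P' * Q') + projOn Ω M) :
    (1 / 2 : ℝ) * frobSq (P' * Q' - P * Q) ≤
        (1 / 2 : ℝ) * frobSq (P * Q - X) - (1 / 2 : ℝ) * frobSq (P' * Q' - X') ∧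
      (0 : ℝ) ≤ (1 / 2 : ℝ) * frobSq (P' * Q' - P * Q) := by
  have hRQ : (P' * Q' - X) * Qᴴ = 0 := by
    have h : P' * Q' - X = (P' * Q - X) - P' * (Q - Q') := by
      rw [Matrix.mul_sub]; abel
    rw [h, Matrix.sub_mul, h1, h3, sub_zero]
  have hQR : Q * (P' * Q' - X)ᴴ = 0 := by
    simpa only [conjTranspose_mul, conjTranspose_conjTranspose, conjTranspose_zero]
      using congrArg conjTranspose hRQ
  have hRP : (P' * Q' - X)ᴴ * P' = 0 := by
    simpa only [conjTranspose_mul, conjTranspose_conjTranspose, conjTranspose_zero]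
      using congrArg conjTranspose h2
  have horth : ((P * Q - P' * Q') * (P' * Q' - X)ᴴ).trace = 0 := by
    rw [Matrix.sub_mul, Matrix.mul_assoc P, hQR, Matrix.mul_zero, zero_sub, trace_neg,
      Matrix.mul_assoc P', trace_mul_comm, Matrix.mul_assoc Q', hRP, Matrix.mul_zero,
      trace_zero, neg_zero]
  have hpyth := frobSq_add_of_trace_eq_zero _ _ horth
  rw [sub_add_sub_cancel, ← frobSq_neg (P * Q - P' * Q'), neg_sub] at hpyth
  have hle := frobSq_sub_projOn_le Ω M X (P' * Q') hX
  rw [← hX'] at hle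
  have hnn := frobSq_nonneg (P' * Q' - P * Q)
  constructor <;> linarith
end
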